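/- Let M = (M_i)_{i≥0} be a sequence of nonnegative integer matrices with nonempty alphabets. Then the edge path space Σ_M^{0,+} is nonempty if and only if the nested cone intersection ⋂_{n≥0} M_0^n C_{n+1} is different from {0}. -/

import Mathlib

open Filter Topology Matrix

noncomputable section

/-- The product `N_k N_{k+1} ⋯ N_{k+m}` of a nonstationary sequence of matrices,
i.e. the matrix written `N_k^n` (with `n = k + m`) in the paper. -/
def matProd {A : ℕ → Type} [∀ i, Fintype (A i)]
    (N : ∀ i, Matrix (A i) (A (i + 1)) ℝ) (k : ℕ) :
    ∀ m : ℕ, Matrix (A k) (A (k + m + 1)) ℝ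
  | 0 => N k
  | m + 1 => matProd N k m * N (k + m + 1)

/-- `V_N^0`: nonnegative fixed-point sequences (`w_i ∈ C_i`, `w_i = N_i w_{i+1}`). -/
def V0 {A : ℕ → Type} [∀ i, Fintype (A i)] (N : ∀ i, Matrix (A i) (A (i + 1)) ℝ) :
    Set (∀ i, A i → ℝ) :=
  {w | (∀ i a, 0 ≤ w i a) ∧ ∀ i, w i = (N i).mulVec (w (i + 1))}

/-- `V_N`: nonnegative eigenvector sequences of eigenvalue one (never zero). -/
def Vpos {A : ℕ → Type} [∀ i, Fintype (A i)] (N : ∀ i, Matrix (A i) (A (i + 1)) ℝ) :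
    Set (∀ i, A i → ℝ) := {w | w ∈ V0 N ∧ ∀ i, w i ≠ 0}

/-- `V_N^Δ`: members of `V_N` whose initial vector lies in the unit simplex `Δ₀`
(for the `L¹` norm `‖u‖ = ∑ₐ |u a|`). -/
def VDelta {A : ℕ → Type} [∀ i, Fintype (A i)] (N : ∀ i, Matrix (A i) (A (i + 1)) ℝ) :
    Set (∀ i, A i → ℝ) := {w | w ∈ Vpos N ∧ ∑ a, |w 0 a| = 1}

/-- The sequence `N` is primitive: for every `k` there is `n > k` (here `n = k + m`, `m ≥ 1`)
such that every entry of `N_k^n` is strictly positive. -/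
def Primitive {A : ℕ → Type} [∀ i, Fintype (A i)] (N : ∀ i, Matrix (A i) (A (i + 1)) ℝ) : Prop :=
  ∀ k, ∃ m, 0 < m ∧ ∀ (a : A k) (b : A (k + m + 1)), 0 < matProd N k m a b

theorem matProd_nonneg {A : ℕ → Type} [∀ i, Fintype (A i)]
    {N : ∀ i, Matrix (A i) (A (i + 1)) ℝ} (hN : ∀ i a b, 0 ≤ N i a b) (k m : ℕ)
    (a : A k) (b : A (k + m + 1)) : 0 ≤ matProd N k m a b := by
  induction m with
  | zero => exact hN k a b
  | succ m ih => exact Finset.sum_nonneg fun c _ => mul_nonneg (ih c) (hN _ c b)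

/-- A path in the support of `N` produces positive entries in the products of `N`. -/
theorem matProd_pos_of_path {A : ℕ → Type} [∀ i, Fintype (A i)]
    {N : ∀ i, Matrix (A i) (A (i + 1)) ℝ} (hN : ∀ i a b, 0 ≤ N i a b)
    (x : ∀ i, A i) (hx : ∀ i, 0 < N i (x i) (x (i + 1))) (k m : ℕ) :
    0 < matProd N k m (x k) (x (k + m + 1)) := by
  induction m with
  | zero => exact hx k
  | succ m ih =>
    exact Finset.sum_pos' (fun c _ => mul_nonneg (matProd_nonneg hN k m _ c) (hN _ c _))
      ⟨x (k + m + 1), Finset.mem_univ _, mul_pos ih (hx (k + m + 1))⟩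

/-- A nonzero entry of `matProd N k m` comes from a finite path of edges. -/
theorem exists_path_of_matProd_ne_zero {A : ℕ → Type} [∀ i, Fintype (A i)]
    {N : ∀ i, Matrix (A i) (A (i + 1)) ℝ} {E : ℕ → Type} [∀ i, Nonempty (E i)]
    {src : ∀ i, E i → A i} {rng : ∀ i, E i → A (i + 1)}
    (hN : ∀ i a b, N i a b ≠ 0 → ∃ e, src i e = a ∧ rng i e = b) (k m : ℕ)
    (a : A k) (b : A (k + m + 1)) (h : matProd N k m a b ≠ 0) :
    ∃ e : ∀ i, E i, rng (k + m) (e (k + m)) = b ∧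
      ∀ i < m, rng (k + i) (e (k + i)) = src (k + i + 1) (e (k + i + 1)) := by
  classical
  induction m with
  | zero =>
    obtain ⟨e, -, he⟩ := hN k a b h
    refine ⟨Function.update (fun i => Classical.arbitrary (E i)) k e, ?_, by simp⟩
    simpa using he
  | succ m ih =>
    obtain ⟨c, -, hc⟩ := Finset.exists_ne_zero_of_sum_ne_zero h
    obtain ⟨e, heb, he⟩ := ih c (left_ne_zero_of_mul hc)
    obtain ⟨f, hfs, hfr⟩ := hN (k + m + 1) c b (right_ne_zero_of_mul hc)
    have hlt : ∀ i ≤ m, Function.update e (k + m + 1) f (k + i) = e (k + i) :=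
      fun i hi => Function.update_of_ne (by omega) _ _
    have hf : Function.update e (k + m + 1) f (k + m + 1) = f := Function.update_self ..
    refine ⟨Function.update e (k + m + 1) f, ?_, fun i hi => ?_⟩
    · exact (congrArg (rng (k + m + 1)) hf).trans hfr
    · rw [hlt i (by omega)]
      rcases Nat.lt_succ_iff_lt_or_eq.mp hi with hi | rfl
      · have := hlt (i + 1) (by omega)
        rw [← add_assoc] at this
        rw [this]
        exact he i hi
      · rw [hf, hfs, heb]

/-- A sequence of composable edges exists as soon as finite ones of every length do. -/
theorem nonempty_path_of_finite_paths {A E : ℕ → Type} [∀ i, Finite (E i)]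
    (src : ∀ i, E i → A i) (rng : ∀ i, E i → A (i + 1))
    (h : ∀ m : ℕ, ∃ e : ∀ i, E i, ∀ i < m, rng i (e i) = src (i + 1) (e (i + 1))) :
    ∃ e : ∀ i, E i, ∀ i, rng i (e i) = src (i + 1) (e (i + 1)) := by
  let _ : ∀ i, TopologicalSpace (E i) := fun _ => ⊥
  have _ : ∀ i, DiscreteTopology (E i) := fun _ => ⟨rfl⟩
  let S : ℕ → Set (∀ i, E i) := fun m => {e | ∀ i < m, rng i (e i) = src (i + 1) (e (i + 1))}
  have hS : ∀ m, IsClosed (S m) := by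
    intro m
    simp only [S, Set.ofPred_forall]
    refine isClosed_iInter fun i => isClosed_iInter fun _ => ?_
    have : Continuous fun e : ∀ i, E i => (e i, e (i + 1)) := by fun_prop
    exact (isClosed_discrete {p : E i × E (i + 1) | rng i p.1 = src (i + 1) p.2}).preimage this
  obtain ⟨e, he⟩ := IsCompact.nonempty_iInter_of_sequence_nonempty_isCompact_isClosed S
    (fun m e he i hi => he i (by omega)) h (hS 0).isCompact hS
  exact ⟨e, fun i => Set.mem_iInter.mp he (i + 1) i (by omega)⟩

/-- The vectors of coordinate sum one in the image of the nonnegative cone under `P`. -/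
def coneSlice {α β : Type*} [Fintype α] [Fintype β] (P : Matrix α β ℝ) : Set (α → ℝ) :=
  {v | ∑ a, v a = 1 ∧ ∃ u : β → ℝ, (∀ b, 0 ≤ u b) ∧ v = P *ᵥ u}

theorem isCompact_coneSlice {α β : Type*} [Fintype α] [Fintype β] {P : Matrix α β ℝ}
    (hP : ∀ a b, 0 ≤ P a b) : IsCompact (coneSlice P) := by
  have hcol : ∀ u : β → ℝ, ∑ a, (P *ᵥ u) a = ∑ b, (∑ a, P a b) * u b := by
    intro u
    simp only [mulVec, dotProduct, Finset.sum_mul]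
    exact Finset.sum_comm
  have hc : ∀ b, 0 ≤ ∑ a, P a b := fun b => Finset.sum_nonneg fun a _ => hP a b
  have hcont : Continuous fun u : β → ℝ => P *ᵥ u := by fun_prop
  have hD : IsCompact (Set.Icc (0 : β → ℝ) (fun b => (∑ a, P a b)⁻¹) ∩
      {u | ∑ a, (P *ᵥ u) a = 1}) :=
    isCompact_Icc.inter_right (isClosed_eq (by fun_prop) continuous_const)
  convert hD.image hcont using 1
  ext v
  constructor
  · rintro ⟨hv, u, hu, rfl⟩
    -- Coordinates of `u` facing a zero column of `P` do not matter and are reset to zero.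
    let u' : β → ℝ := fun b => if ∑ a, P a b = 0 then 0 else u b
    have huu' : P *ᵥ u' = P *ᵥ u := by
      ext a
      refine Finset.sum_congr rfl fun b _ => ?_
      by_cases hb : ∑ a, P a b = 0
      · have := (Finset.sum_eq_zero_iff_of_nonneg fun a _ => hP a b).mp hb a (Finset.mem_univ a)
        simp [this]
      · simp [u', hb]
    refine ⟨u', ⟨⟨fun b => ?_, fun b => ?_⟩, by rw [Set.mem_ofPred_eq, huu', hv]⟩, huu'⟩
    · by_cases hb : ∑ a, P a b = 0 <;> simp [u', hb, hu b]
    · by_cases hb : ∑ a, P a b = 0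
      · simp [u', hb]
      · simp only [u', if_neg hb]
        rw [← one_div, le_div_iff₀' ((hc b).lt_of_ne' hb), ← hv, hcol]
        exact Finset.single_le_sum (f := fun b => (∑ a, P a b) * u b)
          (fun b _ => mul_nonneg (hc b) (hu b)) (Finset.mem_univ b)
  · rintro ⟨u, ⟨⟨hu, -⟩, hsum⟩, rfl⟩
    exact ⟨hsum, u, hu, rfl⟩

theorem coneSlice_nonempty {α β : Type*} [Fintype α] [Fintype β] {P : Matrix α β ℝ}
    (hP : ∀ a b, 0 ≤ P a b) {a : α} {b : β} (hab : 0 < P a b) : (coneSlice P).Nonempty := by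
  classical
  have hpos : 0 < ∑ a, P a b :=
    Finset.sum_pos' (fun a _ => hP a b) ⟨a, Finset.mem_univ a, hab⟩
  refine ⟨_, ?_, Pi.single b (∑ a, P a b)⁻¹, fun c => ?_, rfl⟩
  · simp only [mulVec_single, Pi.smul_apply, MulOpposite.smul_eq_mul_unop,
      MulOpposite.unop_op, col_apply, ← Finset.sum_mul]
    exact mul_inv_cancel₀ hpos.ne'
  · exact (Pi.single_nonneg (α := fun _ : β => ℝ)).mpr (inv_nonneg.mpr hpos.le) c

theorem coneSlice_mul_subset {α β γ : Type*} [Fintype α] [Fintype β] [Fintype γ]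
    (P : Matrix α β ℝ) {Q : Matrix β γ ℝ} (hQ : ∀ b c, 0 ≤ Q b c) :
    coneSlice (P * Q) ⊆ coneSlice P := by
  rintro v ⟨hv, u, hu, rfl⟩
  exact ⟨hv, Q *ᵥ u, fun b => Finset.sum_nonneg fun c _ => mul_nonneg (hQ b c) (hu c),
    (mulVec_mulVec u P Q).symm⟩

/-- for a sequence `M` of nonnegative integer matrices (realized as the counting
matrices of a Bratteli diagram with edge sets `E i`, source maps `src` and range maps `rng`),
the edge path space `Σ_M^{0,+}` is nonempty if and only if the nested cone intersection
`⋂ₙ M_0^n C_{n+1}` is different from `{0}`. -/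
theorem statement9 (A : ℕ → Type) [∀ i, Fintype (A i)] [∀ i, Nonempty (A i)]
    (M : ∀ i, Matrix (A i) (A (i + 1)) ℝ)
    (E : ℕ → Type) [∀ i, Fintype (E i)]
    (src : ∀ i, E i → A i) (rng : ∀ i, E i → A (i + 1))
    (hM : ∀ i a b, M i a b = (Nat.card {e : E i // src i e = a ∧ rng i e = b} : ℝ)) :
    Nonempty {e : ∀ i, E i // ∀ i, rng i (e i) = src (i + 1) (e (i + 1))} ↔
      (⋂ m : ℕ, {v : A 0 → ℝ | ∃ u : A (0 + m + 1) → ℝ,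
        (∀ b, 0 ≤ u b) ∧ v = (matProd M 0 m).mulVec u}) ≠ {0} := by
  have hN : ∀ i a b, 0 ≤ M i a b := fun i a b => by rw [hM]; positivity
  have hedge : ∀ i a b, M i a b ≠ 0 → ∃ e, src i e = a ∧ rng i e = b := by
    intro i a b h
    rw [hM, Nat.cast_ne_zero, Nat.card_ne_zero] at h
    obtain ⟨⟨e, he⟩⟩ := h.1
    exact ⟨e, he⟩
  constructor
  · rintro ⟨e, he⟩ h0
    have hpos : ∀ i, 0 < M i (src i (e i)) (src (i + 1) (e (i + 1))) := by
      intro i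
      rw [hM, Nat.cast_pos]
      have : Nonempty {f : E i // src i f = src i (e i) ∧ rng i f = src (i + 1) (e (i + 1))} :=
        ⟨e i, rfl, he i⟩
      exact Nat.card_pos
    have hcomp := fun m => isCompact_coneSlice (matProd_nonneg hN 0 m)
    obtain ⟨v, hv⟩ := IsCompact.nonempty_iInter_of_sequence_nonempty_isCompact_isClosed
      (fun m => coneSlice (matProd M 0 m))
      (fun m => coneSlice_mul_subset (matProd M 0 m) (hN (0 + m + 1)))
      (fun m => coneSlice_nonempty (matProd_nonneg hN 0 m)
        (matProd_pos_of_path hN (fun i => src i (e i)) hpos 0 m))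
      (hcomp 0) (fun m => (hcomp m).isClosed)
    rw [Set.mem_iInter] at hv
    have hv0 : v = 0 := by
      rw [← Set.mem_singleton_iff, ← h0]
      exact Set.mem_iInter.mpr fun m => (hv m).2
    simpa [hv0] using (hv 0).1
  · intro h
    obtain ⟨v, hv, hv0⟩ : ∃ v ∈ ⋂ m : ℕ, {v : A 0 → ℝ | ∃ u : A (0 + m + 1) → ℝ,
        (∀ b, 0 ≤ u b) ∧ v = (matProd M 0 m).mulVec u}, v ≠ 0 := by
      by_contra! hall
      refine h (Set.eq_singleton_iff_unique_mem.mpr ⟨?_, hall⟩)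
      exact Set.mem_iInter.mpr fun m => ⟨0, fun _ => le_rfl, (mulVec_zero _).symm⟩
    rw [Set.mem_iInter] at hv
    have hne : ∀ m, ∃ a b, matProd M 0 m a b ≠ 0 := by
      intro m
      obtain ⟨u, -, rfl⟩ := hv m
      by_contra! hall
      exact hv0 (by rw [show matProd M 0 m = 0 from Matrix.ext hall, zero_mulVec])
    have hE : ∀ i, Nonempty (E i) := by
      rintro (_ | i)
      · obtain ⟨a, b, hab⟩ := hne 0
        exact ⟨(hedge 0 a b hab).choose⟩
      · obtain ⟨a, b, hab⟩ := hne (i + 1)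
        obtain ⟨c, -, hc⟩ := Finset.exists_ne_zero_of_sum_ne_zero hab
        have := (hedge (0 + i + 1) c b (right_ne_zero_of_mul hc)).choose
        rw [zero_add] at this
        exact ⟨this⟩
    obtain ⟨e, he⟩ := nonempty_path_of_finite_paths src rng fun m => by
      obtain ⟨a, b, hab⟩ := hne m
      obtain ⟨e, -, he⟩ := exists_path_of_matProd_ne_zero hedge 0 m a b hab
      refine ⟨e, fun i hi => ?_⟩
      have := he i hi
      rwa [zero_add] at this
    exact ⟨e, he⟩
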